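/- Let η ∈ C³ ∩ W^{3,∞}(ℝ²), ρ ∈ L¹(ℝ²), J₁(x,y) = -ε ∂₁(η*ρ)(x,y)/√(1+‖∇(η*ρ)(x,y)‖²), and let x₋, x₀, x₊ be three consecutive equally spaced points with spacing Δx. Then the second difference satisfies |J₁(x₊,y) - 2 J₁(x₀,y) + J₁(x₋,y)| ≤ 2 ε (Δx)² (2 ‖∇³η‖_{L∞} ‖ρ‖_{L¹} + 3 ‖∇²η‖²_{L∞} ‖ρ‖²_{L¹}). -/

import Mathlib

open MeasureTheory

set_option maxSynthPendingDepth 3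

section Convolution

variable {E G : Type*} [NormedAddCommGroup E] [MeasurableSpace E] [NormedAddCommGroup G]
  [NormedSpace ℝ G] {μ : Measure E} {ρ : E → ℝ}

lemma norm_integral_smul_translate_le {F : E → G} {C : ℝ}
    (hC : ∀ w, ‖F w‖ ≤ C) (hρ : Integrable ρ μ) (z : E) :
    ‖∫ p, ρ p • F (z - p) ∂μ‖ ≤ C * ∫ p, |ρ p| ∂μ := by
  rw [mul_comm, ← integral_mul_const]
  refine norm_integral_le_of_norm_le (hρ.norm.mul_const C) ?_
  refine Filter.Eventually.of_forall fun p => ?_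
  rw [norm_smul]
  exact mul_le_mul_of_nonneg_left (hC _) (norm_nonneg _)

variable [BorelSpace E] [SecondCountableTopology E]

lemma aestronglyMeasurable_smul_translate {F : E → G} (hF : Continuous F)
    (hρ : Integrable ρ μ) (z : E) :
    AEStronglyMeasurable (fun p => ρ p • F (z - p)) μ :=
  hρ.aestronglyMeasurable.smul (hF.comp (continuous_const.sub continuous_id)).aestronglyMeasurable

lemma integrable_smul_translate_of_bounded {F : E → G} (hF : Continuous F) {C : ℝ}
    (hC : ∀ w, ‖F w‖ ≤ C) (hρ : Integrable ρ μ) (z : E) :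
    Integrable (fun p => ρ p • F (z - p)) μ := by
  refine (hρ.norm.mul_const C).mono' (aestronglyMeasurable_smul_translate hF hρ z) ?_
  refine Filter.Eventually.of_forall fun p => ?_
  rw [norm_smul]
  exact mul_le_mul_of_nonneg_left (hC _) (norm_nonneg _)

variable [NormedSpace ℝ E]

lemma hasFDerivAt_integral_smul_translate {F : E → G} (hF : ContDiff ℝ 1 F)
    (hρ : Integrable ρ μ) {z : E} (hint : Integrable (fun p => ρ p • F (z - p)) μ) {b : E → ℝ}
    (hb : ∀ p, ∀ h : E, ‖h‖ ≤ 1 → ‖fderiv ℝ F (z - p + h)‖ ≤ b p)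
    (hbint : Integrable (fun p => ‖ρ p‖ * b p) μ) :
    HasFDerivAt (fun z => ∫ p, ρ p • F (z - p) ∂μ) (∫ p, ρ p • fderiv ℝ F (z - p) ∂μ) z := by
  refine hasFDerivAt_integral_of_dominated_of_fderiv_le
    (F' := fun z p => ρ p • fderiv ℝ F (z - p)) (bound := fun p => ‖ρ p‖ * b p)
    (Metric.ball_mem_nhds z one_pos)
    (Filter.Eventually.of_forall fun w => aestronglyMeasurable_smul_translate hF.continuous hρ w)
    hint (aestronglyMeasurable_smul_translate (hF.continuous_fderiv one_ne_zero) hρ z) ?_ hbint ?_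
  · refine Filter.Eventually.of_forall fun p w hw => ?_
    rw [norm_smul]
    refine mul_le_mul_of_nonneg_left ?_ (norm_nonneg _)
    have := hb p (w - z) (by rw [← dist_eq_norm]; exact (Metric.mem_ball.1 hw).le)
    rwa [show z - p + (w - z) = w - p by abel] at this
  · refine Filter.Eventually.of_forall fun p w _ => ?_
    have h1 := ((hF.differentiable one_ne_zero) (w - p)).hasFDerivAt
    have h2 : HasFDerivAt (fun w : E => w - p) (ContinuousLinearMap.id ℝ E) w :=
      (hasFDerivAt_id w).sub_const p
    simpa [Function.comp_def] using (h1.comp w h2).fun_const_smul (ρ p)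

lemma hasFDerivAt_integral_smul_translate_of_bounded {F : E → G} (hF : ContDiff ℝ 1 F)
    (hρ : Integrable ρ μ) {z : E} (hint : Integrable (fun p => ρ p • F (z - p)) μ) {C : ℝ}
    (hC : ∀ w, ‖fderiv ℝ F w‖ ≤ C) :
    HasFDerivAt (fun z => ∫ p, ρ p • F (z - p) ∂μ) (∫ p, ρ p • fderiv ℝ F (z - p) ∂μ) z :=
  hasFDerivAt_integral_smul_translate hF hρ hint (b := fun _ => C) (fun _ _ _ => hC _)
    (hρ.norm.mul_const C)

end Convolution

section NonnegBoundedHessian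

variable {E : Type*} [NormedAddCommGroup E] [NormedSpace ℝ E] {f : E → ℝ} {M : ℝ}

lemma norm_fderiv_sub_le_of_fderiv_fderiv_le (hf : ContDiff ℝ 2 f)
    (hM : ∀ w, ‖fderiv ℝ (fderiv ℝ f) w‖ ≤ M) (x y : E) :
    ‖fderiv ℝ f y - fderiv ℝ f x‖ ≤ M * ‖y - x‖ :=
  convex_univ.norm_image_sub_le_of_norm_fderiv_le
    (fun w _ => (hf.fderiv_right (m := 1) le_rfl).differentiable one_ne_zero w)
    (fun w _ => hM w) (Set.mem_univ x) (Set.mem_univ y)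

/-- A nonnegative function with bounded Hessian controls its own gradient. -/
lemma norm_fderiv_le_of_nonneg (hf : ContDiff ℝ 2 f) (hpos : ∀ w, 0 ≤ f w)
    (hM : ∀ w, ‖fderiv ℝ (fderiv ℝ f) w‖ ≤ M) (x : E) :
    ‖fderiv ℝ f x‖ ≤ f x + M := by
  have hM0 : 0 ≤ M := (norm_nonneg _).trans (hM x)
  have key : ∀ v : E, ‖v‖ = 1 → -(fderiv ℝ f x v) ≤ f x + M := by
    intro v hv
    have h := (convex_closedBall x (1 : ℝ)).norm_image_sub_le_of_norm_fderiv_le'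
      (f := f) (φ := fderiv ℝ f x) (C := M) (x := x) (y := x + v) (𝕜 := ℝ)
      (fun w _ => hf.differentiable two_ne_zero w)
      (fun w hw => (norm_fderiv_sub_le_of_fderiv_fderiv_le hf hM x w).trans (by
        have : ‖w - x‖ ≤ 1 := by simpa [dist_eq_norm] using hw
        nlinarith))
      (by simp) (by simp [hv])
    rw [add_sub_cancel_left, hv, mul_one, Real.norm_eq_abs, abs_le] at h
    linarith [h.2, hpos (x + v)]
  refine ContinuousLinearMap.opNorm_le_of_unit_norm (add_nonneg (hpos x) hM0) fun v hv => ?_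
  rw [Real.norm_eq_abs, abs_le]
  have h1 := key v hv
  have h2 := key (-v) (by rwa [norm_neg])
  rw [map_neg] at h2
  constructor <;> linarith

lemma norm_fderiv_add_le_of_nonneg (hf : ContDiff ℝ 2 f) (hpos : ∀ w, 0 ≤ f w)
    (hM : ∀ w, ‖fderiv ℝ (fderiv ℝ f) w‖ ≤ M) (x h : E) :
    ‖fderiv ℝ f (x + h)‖ ≤ f x + M + M * ‖h‖ := by
  have h1 := norm_fderiv_sub_le_of_fderiv_fderiv_le hf hM x (x + h)
  rw [add_sub_cancel_left] at h1
  have h2 := norm_fderiv_le_of_nonneg hf hpos hM x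
  have h3 := norm_add_le (fderiv ℝ f (x + h) - fderiv ℝ f x) (fderiv ℝ f x)
  rw [sub_add_cancel] at h3
  linarith

lemma apply_add_le_of_nonneg (hf : ContDiff ℝ 2 f) (hpos : ∀ w, 0 ≤ f w)
    (hM : ∀ w, ‖fderiv ℝ (fderiv ℝ f) w‖ ≤ M) (x h : E) :
    f (x + h) ≤ f x + (f x + M + M * ‖h‖) * ‖h‖ := by
  have hM0 : 0 ≤ M := (norm_nonneg _).trans (hM x)
  have := (convex_closedBall x ‖h‖).norm_image_sub_le_of_norm_fderiv_le
      (f := f) (C := f x + M + M * ‖h‖) (x := x) (y := x + h) (𝕜 := ℝ)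
      (fun w _ => hf.differentiable two_ne_zero w)
      (fun w hw => by
        have hw' : ‖w - x‖ ≤ ‖h‖ := by simpa [dist_eq_norm] using hw
        have := norm_fderiv_add_le_of_nonneg hf hpos hM x (w - x)
        rw [add_sub_cancel] at this
        nlinarith)
      (by simp) (by simp)
  rw [add_sub_cancel_left, Real.norm_eq_abs, abs_le] at this
  linarith [this.2]

variable [MeasurableSpace E] [BorelSpace E] [SecondCountableTopology E] {μ : Measure E} {ρ : E → ℝ}

lemma integrable_smul_translate_of_nonneg (hf : ContDiff ℝ 2 f) (hpos : ∀ w, 0 ≤ f w)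
    (hM : ∀ w, ‖fderiv ℝ (fderiv ℝ f) w‖ ≤ M) (hρ : Integrable ρ μ) {z₀ : E}
    (hint : Integrable (fun p => ρ p • f (z₀ - p)) μ) (z : E) :
    Integrable (fun p => ρ p • f (z - p)) μ := by
  have hb : Integrable (fun p => ‖ρ p • f (z₀ - p)‖ * (1 + ‖z - z₀‖)
      + ‖ρ p‖ * ((M + M * ‖z - z₀‖) * ‖z - z₀‖)) μ :=
    (hint.norm.mul_const _).add (hρ.norm.mul_const _)
  refine hb.mono' (aestronglyMeasurable_smul_translate hf.continuous hρ z) ?_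
  refine Filter.Eventually.of_forall fun p => ?_
  have h1 := apply_add_le_of_nonneg hf hpos hM (z₀ - p) (z - z₀)
  rw [show z₀ - p + (z - z₀) = z - p by abel] at h1
  simp only [norm_smul, Real.norm_of_nonneg (hpos _)]
  have := mul_le_mul_of_nonneg_left h1 (norm_nonneg (ρ p))
  linarith

lemma integrable_smul_fderiv_translate_of_nonneg (hf : ContDiff ℝ 2 f) (hpos : ∀ w, 0 ≤ f w)
    (hM : ∀ w, ‖fderiv ℝ (fderiv ℝ f) w‖ ≤ M) (hρ : Integrable ρ μ) {z : E}
    (hint : Integrable (fun p => ρ p • f (z - p)) μ) :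
    Integrable (fun p => ρ p • fderiv ℝ f (z - p)) μ := by
  have hb : Integrable (fun p => ‖ρ p • f (z - p)‖ + ‖ρ p‖ * M) μ :=
    hint.norm.add (hρ.norm.mul_const _)
  refine hb.mono'
    (aestronglyMeasurable_smul_translate (hf.continuous_fderiv two_ne_zero) hρ z) ?_
  refine Filter.Eventually.of_forall fun p => ?_
  have h1 := norm_fderiv_le_of_nonneg hf hpos hM (z - p)
  simp only [norm_smul, Real.norm_of_nonneg (hpos _)]
  have := mul_le_mul_of_nonneg_left h1 (norm_nonneg (ρ p))
  linarith

lemma hasFDerivAt_integral_smul_translate_of_nonneg (hf : ContDiff ℝ 2 f) (hpos : ∀ w, 0 ≤ f w)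
    (hM : ∀ w, ‖fderiv ℝ (fderiv ℝ f) w‖ ≤ M) (hρ : Integrable ρ μ) {z : E}
    (hint : Integrable (fun p => ρ p • f (z - p)) μ) :
    HasFDerivAt (fun z => ∫ p, ρ p • f (z - p) ∂μ) (∫ p, ρ p • fderiv ℝ f (z - p) ∂μ) z := by
  refine hasFDerivAt_integral_smul_translate (hf.of_le one_le_two) hρ hint
    (b := fun p => f (z - p) + M + M) (fun p h hh => ?_) ?_
  · have hM0 : 0 ≤ M := (norm_nonneg _).trans (hM 0)
    have := norm_fderiv_add_le_of_nonneg hf hpos hM (z - p) h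
    nlinarith
  · have hb : Integrable (fun p => ‖ρ p • f (z - p)‖ + ‖ρ p‖ * (M + M)) μ :=
      hint.norm.add (hρ.norm.mul_const _)
    refine hb.congr (Filter.Eventually.of_forall fun p => ?_)
    simp only [norm_smul, Real.norm_of_nonneg (hpos _)]
    ring

end NonnegBoundedHessian

lemma abs_second_difference_le {g g' g'' : ℝ → ℝ} {C : ℝ} (hg : ∀ x, HasDerivAt g (g' x) x)
    (hg' : ∀ x, HasDerivAt g' (g'' x) x) (hC : ∀ x, |g'' x| ≤ C) (x h : ℝ) :
    |g (x + 2 * h) - 2 * g (x + h) + g x| ≤ C * h ^ 2 := by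
  have h1 : ∀ t, ‖g' (t + h) - g' t‖ ≤ C * |h| := fun t => by
    have := convex_univ.norm_image_sub_le_of_norm_hasDerivWithin_le (f := g')
      (fun x _ => (hg' x).hasDerivWithinAt) (fun x _ => hC x) (Set.mem_univ t)
      (Set.mem_univ (t + h))
    simpa using this
  have h2 : ∀ t, HasDerivAt (fun t => g (t + h) - g t) (g' (t + h) - g' t) t := fun t =>
    ((hg (t + h)).comp_add_const t h).sub (hg t)
  have h3 := convex_univ.norm_image_sub_le_of_norm_hasDerivWithin_le
    (fun x _ => (h2 x).hasDerivWithinAt) (fun x _ => h1 x) (Set.mem_univ x) (Set.mem_univ (x + h))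
  rw [add_sub_cancel_left, Real.norm_eq_abs, Real.norm_eq_abs, mul_assoc, abs_mul_abs_self,
    ← pow_two] at h3
  convert h3 using 2
  ring_nf

section NormalizedComponent

lemma hasDerivAt_sqrt_one_add_sq_add_sq {u v : ℝ → ℝ} {u' v' x : ℝ}
    (hu : HasDerivAt u u' x) (hv : HasDerivAt v v' x) :
    HasDerivAt (fun t => √(1 + u t ^ 2 + v t ^ 2))
      ((u x * u' + v x * v') / √(1 + u x ^ 2 + v x ^ 2)) x := by
  have h := (((hu.fun_pow 2).const_add 1).fun_add (hv.fun_pow 2)).sqrt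
    (show 1 + u x ^ 2 + v x ^ 2 ≠ 0 by positivity)
  convert h using 1
  field_simp
  ring

/-- The second derivative of `u / √(1 + u² + v²)` expressed through the values
`a, b` of `u, v` and of their first two derivatives. -/
noncomputable def normalizedSecondDeriv (a b a' b' a'' b'' : ℝ) : ℝ :=
  (a'' * (1 + b ^ 2) + a' * b * b' - a * b * b'' - a * b' ^ 2) / √(1 + a ^ 2 + b ^ 2) ^ 3
    - 3 * (a' * (1 + b ^ 2) - a * b * b') * (a * a' + b * b') / √(1 + a ^ 2 + b ^ 2) ^ 5

lemma hasDerivAt_normalized {u v : ℝ → ℝ} {u' v' x : ℝ}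
    (hu : HasDerivAt u u' x) (hv : HasDerivAt v v' x) :
    HasDerivAt (fun t => u t / √(1 + u t ^ 2 + v t ^ 2))
      ((u' * (1 + v x ^ 2) - u x * v x * v') / √(1 + u x ^ 2 + v x ^ 2) ^ 3) x := by
  have hpos : 0 < √(1 + u x ^ 2 + v x ^ 2) := Real.sqrt_pos.2 (by positivity)
  have hsq : √(1 + u x ^ 2 + v x ^ 2) ^ 2 = 1 + u x ^ 2 + v x ^ 2 := Real.sq_sqrt (by positivity)
  refine (hu.fun_div (hasDerivAt_sqrt_one_add_sq_add_sq hu hv) hpos.ne').congr_deriv ?_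
  generalize √(1 + u x ^ 2 + v x ^ 2) = W at *
  field_simp
  rw [hsq]
  ring

lemma hasDerivAt_deriv_normalized {u v u' v' : ℝ → ℝ} {u'' v'' x : ℝ}
    (hu : HasDerivAt u (u' x) x) (hv : HasDerivAt v (v' x) x)
    (hu' : HasDerivAt u' u'' x) (hv' : HasDerivAt v' v'' x) :
    HasDerivAt
      (fun t => (u' t * (1 + v t ^ 2) - u t * v t * v' t) / √(1 + u t ^ 2 + v t ^ 2) ^ 3)
      (normalizedSecondDeriv (u x) (v x) (u' x) (v' x) u'' v'') x := by
  have hpos : 0 < √(1 + u x ^ 2 + v x ^ 2) := Real.sqrt_pos.2 (by positivity)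
  refine (((hu'.fun_mul ((hv.fun_pow 2).const_add 1)).fun_sub
    ((hu.fun_mul hv).fun_mul hv')).fun_div
    ((hasDerivAt_sqrt_one_add_sq_add_sq hu hv).fun_pow 3) (pow_pos hpos 3).ne').congr_deriv ?_
  unfold normalizedSecondDeriv
  generalize √(1 + u x ^ 2 + v x ^ 2) = W at *
  field_simp
  ring

lemma abs_normalizedSecondDeriv_le {a b a' b' a'' b'' A B : ℝ}
    (hA : |a'| + |b'| ≤ A) (hB : |a''| + |b''| ≤ B) :
    |normalizedSecondDeriv a b a' b' a'' b''| ≤ B + 4 * A ^ 2 := by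
  have hsq : √(1 + a ^ 2 + b ^ 2) ^ 2 = 1 + a ^ 2 + b ^ 2 := Real.sq_sqrt (by positivity)
  have hW1 : 1 ≤ √(1 + a ^ 2 + b ^ 2) := Real.one_le_sqrt.2 (by nlinarith [sq_nonneg a, sq_nonneg b])
  unfold normalizedSecondDeriv
  generalize √(1 + a ^ 2 + b ^ 2) = W at *
  have hW0 : 0 < W := by linarith
  have ha : |a| ≤ W := abs_le_of_sq_le_sq (by nlinarith [sq_nonneg b]) hW0.le
  have hb : |b| ≤ W := abs_le_of_sq_le_sq (by nlinarith [sq_nonneg a]) hW0.le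
  have hab : |a * b| ≤ W ^ 2 := by
    rw [abs_mul, pow_two]; exact mul_le_mul ha hb (abs_nonneg _) hW0.le
  have hbb : |1 + b ^ 2| ≤ W ^ 2 := by
    rw [abs_of_nonneg (by positivity)]; nlinarith [sq_nonneg a]
  have lin : ∀ {p q r s K L : ℝ}, |p| ≤ K → |q| ≤ K → |r| + |s| ≤ L → |r * p - s * q| ≤ L * K := by
    intro p q r s K L hp hq hrs
    have hK : 0 ≤ K := (abs_nonneg p).trans hp
    calc |r * p - s * q| ≤ |r * p| + |s * q| := abs_sub _ _
      _ = |r| * |p| + |s| * |q| := by rw [abs_mul, abs_mul]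
      _ ≤ |r| * K + |s| * K := by gcongr
      _ = (|r| + |s|) * K := by ring
      _ ≤ L * K := by gcongr
  have hA0 : 0 ≤ A := (add_nonneg (abs_nonneg _) (abs_nonneg _)).trans hA
  have hB0 : 0 ≤ B := (add_nonneg (abs_nonneg _) (abs_nonneg _)).trans hB
  have e1 := lin hbb hab hB
  have e2 := lin hb ha hA
  have e3 := lin hbb hab hA
  have e4 := lin (q := -b) ha (by rwa [abs_neg]) hA
  have hb' : |b'| ≤ A := by linarith [abs_nonneg a']
  have n1 : |a'' * (1 + b ^ 2) + a' * b * b' - a * b * b'' - a * b' ^ 2| ≤ (B + A ^ 2) * W ^ 3 := by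
    calc _ = |(a'' * (1 + b ^ 2) - b'' * (a * b)) + b' * (a' * b - b' * a)| := by ring_nf
      _ ≤ |a'' * (1 + b ^ 2) - b'' * (a * b)| + |b'| * |a' * b - b' * a| := by
        rw [← abs_mul]; exact abs_add_le _ _
      _ ≤ B * W ^ 2 + A * (A * W) := by gcongr
      _ ≤ B * W ^ 3 + A ^ 2 * W ^ 3 := by
        have : W ^ 2 ≤ W ^ 3 := pow_le_pow_right₀ hW1 (by norm_num)
        have : W ≤ W ^ 3 := le_self_pow₀ hW1 (by norm_num)
        have : A * (A * W) = A ^ 2 * W := by ring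
        rw [this]; gcongr
      _ = _ := by ring
  have n2 : |3 * (a' * (1 + b ^ 2) - a * b * b') * (a * a' + b * b')| ≤ 3 * A ^ 2 * W ^ 5 := by
    calc _ = 3 * |a' * (1 + b ^ 2) - b' * (a * b)| * |a' * a - b' * -b| := by
          rw [← abs_of_pos (show (0 : ℝ) < 3 by norm_num), ← abs_mul, ← abs_mul,
            abs_of_pos (show (0 : ℝ) < 3 by norm_num)]
          ring_nf
      _ ≤ 3 * (A * W ^ 2) * (A * W) := by gcongr
      _ = 3 * A ^ 2 * W ^ 3 := by ring
      _ ≤ 3 * A ^ 2 * W ^ 5 := by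
        have : W ^ 3 ≤ W ^ 5 := pow_le_pow_right₀ hW1 (by norm_num)
        gcongr
  refine (abs_sub _ _).trans ?_
  rw [abs_div, abs_div, abs_of_pos (pow_pos hW0 3), abs_of_pos (pow_pos hW0 5)]
  have m1 := (div_le_iff₀ (pow_pos hW0 3)).2 n1
  have m2 := (div_le_iff₀ (pow_pos hW0 5)).2 n2
  linarith

end NormalizedComponent

lemma abs_apply_add_abs_apply_le (L : ℝ × ℝ →L[ℝ] ℝ) : |L (1, 0)| + |L (0, 1)| ≤ ‖L‖ := by
  have key : ∀ s : ℝ, |s| = 1 → |L (1, 0) + s * L (0, 1)| ≤ ‖L‖ := fun s hs => by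
    have h : L (1, 0) + s * L (0, 1) = L (1, s) := by
      rw [← smul_eq_mul, ← map_smul, ← map_add]; simp
    have hn : ‖((1 : ℝ), s)‖ = 1 := by simp [Prod.norm_def, hs]
    rw [h, ← Real.norm_eq_abs]
    simpa [hn] using L.le_opNorm (1, s)
  have h1 := abs_le.1 (key 1 (by simp))
  have h2 := abs_le.1 (key (-1) (by simp))
  rcases abs_cases (L (1, 0)) with ⟨h3, _⟩ | ⟨h3, _⟩ <;>
  rcases abs_cases (L (0, 1)) with ⟨h4, _⟩ | ⟨h4, _⟩ <;> rw [h3, h4] <;> linarith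

lemma HasFDerivAt.hasDerivAt_fst {G : Type*} [NormedAddCommGroup G] [NormedSpace ℝ G]
    {F : ℝ × ℝ → G} {L : ℝ × ℝ →L[ℝ] G} {x y : ℝ} (h : HasFDerivAt F L (x, y)) :
    HasDerivAt (fun t => F (t, y)) (L (1, 0)) x :=
  h.comp_hasDerivAt x ((hasDerivAt_id x).prodMk (hasDerivAt_const x y))

lemma HasFDerivAt.hasDerivAt_snd {G : Type*} [NormedAddCommGroup G] [NormedSpace ℝ G]
    {F : ℝ × ℝ → G} {L : ℝ × ℝ →L[ℝ] G} {x y : ℝ} (h : HasFDerivAt F L (x, y)) :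
    HasDerivAt (fun t => F (x, t)) (L (0, 1)) y :=
  h.comp_hasDerivAt y ((hasDerivAt_const y x).prodMk (hasDerivAt_id y))

/-- For `η ∈ C³ ∩ W^{3,∞}(ℝ²)` nonnegative and `ρ ∈ L¹(ℝ²)`, with
`J₁ = -ε ∂₁(η*ρ)/√(1+‖∇(η*ρ)‖²)` and three consecutive equally spaced points
`xm, x0 = xm + Δx, xp = xm + 2Δx`, the second difference satisfies
`|J₁(xp,y) - 2 J₁(x0,y) + J₁(xm,y)| ≤ 2 ε Δx² (2‖∇³η‖ ‖ρ‖₁ + 3‖∇²η‖² ‖ρ‖₁²)`. -/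
theorem stmt_5 (ε : ℝ) (hε : 0 < ε)
    (η ρ : ℝ × ℝ → ℝ) (hη : ContDiff ℝ 3 η) (hηpos : ∀ p, 0 ≤ η p)
    (M2 M3 : ℝ)
    (hM2 : ∀ p, ‖iteratedFDeriv ℝ 2 η p‖ ≤ M2)
    (hM3 : ∀ p, ‖iteratedFDeriv ℝ 3 η p‖ ≤ M3)
    (hρ : Integrable ρ)
    (conv : ℝ → ℝ → ℝ)
    (hconv : ∀ x y, conv x y = ∫ p : ℝ × ℝ, η (x - p.1, y - p.2) * ρ p)
    (d1 d2 : ℝ → ℝ → ℝ)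
    (hd1 : ∀ x y, d1 x y = deriv (fun t => conv t y) x)
    (hd2 : ∀ x y, d2 x y = deriv (fun t => conv x t) y)
    (J₁ : ℝ → ℝ → ℝ)
    (hJ₁ : ∀ x y, J₁ x y =
      -(ε * d1 x y / Real.sqrt (1 + (d1 x y) ^ 2 + (d2 x y) ^ 2)))
    (xm x0 xp y Δx : ℝ) (hΔx : 0 < Δx)
    (hx0 : x0 = xm + Δx) (hxp : xp = xm + 2 * Δx) :
    |J₁ xp y - 2 * J₁ x0 y + J₁ xm y| ≤
      2 * ε * Δx ^ 2 *
        (2 * M3 * (∫ p, |ρ p|) + 3 * M2 ^ 2 * (∫ p, |ρ p|) ^ 2) := by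
  have hM2' : ∀ w, ‖fderiv ℝ (fderiv ℝ η) w‖ ≤ M2 := fun w => by
    have := hM2 w
    rwa [← norm_iteratedFDeriv_fderiv, norm_iteratedFDeriv_one] at this
  have hM3' : ∀ w, ‖fderiv ℝ (fderiv ℝ (fderiv ℝ η)) w‖ ≤ M3 := fun w => by
    have := hM3 w
    rwa [← norm_iteratedFDeriv_fderiv, ← norm_iteratedFDeriv_fderiv,
      norm_iteratedFDeriv_one] at this
  have hM30 : 0 ≤ M3 := (norm_nonneg _).trans (hM3 0)
  have hR0 : 0 ≤ ∫ p, |ρ p| := integral_nonneg fun p => abs_nonneg _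
  have hη2 : ContDiff ℝ 2 η := hη.of_le (by norm_num)
  have hDη : ContDiff ℝ 2 (fderiv ℝ η) := hη.fderiv_right (by norm_num)
  have hDDη : ContDiff ℝ 1 (fderiv ℝ (fderiv ℝ η)) := hDη.fderiv_right (by norm_num)
  have hconv' : ∀ x y, conv x y = ∫ p, ρ p • η ((x, y) - p) := fun x y => by
    rw [hconv]
    exact integral_congr_ae (Filter.Eventually.of_forall fun p => mul_comm _ _)
  by_cases hex : ∃ z₀ : ℝ × ℝ, Integrable (fun p => ρ p • η (z₀ - p))
  · obtain ⟨z₀, hz₀⟩ := hex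
    have hint := integrable_smul_translate_of_nonneg hη2 hηpos hM2' hρ hz₀
    have D0 := fun z => hasFDerivAt_integral_smul_translate_of_nonneg hη2 hηpos hM2' hρ (hint z)
    have D1 := fun z => hasFDerivAt_integral_smul_translate_of_bounded (hDη.of_le one_le_two) hρ
      (integrable_smul_fderiv_translate_of_nonneg hη2 hηpos hM2' hρ (hint z)) hM2'
    have D2 := fun z => hasFDerivAt_integral_smul_translate_of_bounded hDDη hρ
      (integrable_smul_translate_of_bounded hDDη.continuous hM2' hρ z) hM3'
    have N2 := norm_integral_smul_translate_le hM2' hρ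
    have N3 := norm_integral_smul_translate_le hM3' hρ
    set C1 := fun z : ℝ × ℝ => ∫ p, ρ p • fderiv ℝ η (z - p)
    set C2 := fun z : ℝ × ℝ => ∫ p, ρ p • fderiv ℝ (fderiv ℝ η) (z - p)
    set C3 := fun z : ℝ × ℝ => ∫ p, ρ p • fderiv ℝ (fderiv ℝ (fderiv ℝ η)) (z - p)
    change ∀ z, ‖C2 z‖ ≤ _ at N2
    change ∀ z, ‖C3 z‖ ≤ _ at N3
    have hd1' : ∀ x y, d1 x y = C1 (x, y) (1, 0) := fun x y => by
      simp only [hd1, hconv']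
      exact (D0 (x, y)).hasDerivAt_fst.deriv
    have hd2' : ∀ x y, d2 x y = C1 (x, y) (0, 1) := fun x y => by
      simp only [hd2, hconv']
      exact (D0 (x, y)).hasDerivAt_snd.deriv
    have H1 : ∀ e x, HasDerivAt (fun t => C1 (t, y) e) (C2 (x, y) (1, 0) e) x := fun e x =>
      by simpa using (D1 (x, y)).hasDerivAt_fst.clm_apply (hasDerivAt_const x e)
    have H2 : ∀ e x, HasDerivAt (fun t => C2 (t, y) (1, 0) e) (C3 (x, y) (1, 0) (1, 0) e) x :=
      fun e x => by
        simpa using ((D2 (x, y)).hasDerivAt_fst.clm_apply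
          (hasDerivAt_const x ((1 : ℝ), (0 : ℝ)))).clm_apply (hasDerivAt_const x e)
    have he : ‖((1 : ℝ), (0 : ℝ))‖ = 1 := by simp [Prod.norm_def]
    have B1 : ∀ x, |C2 (x, y) (1, 0) (1, 0)| + |C2 (x, y) (1, 0) (0, 1)| ≤ M2 * ∫ p, |ρ p| :=
      fun x => (abs_apply_add_abs_apply_le _).trans
        (((C2 (x, y)).unit_le_opNorm _ he.le).trans (N2 _))
    have B2 : ∀ x, |C3 (x, y) (1, 0) (1, 0) (1, 0)| + |C3 (x, y) (1, 0) (1, 0) (0, 1)|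
        ≤ M3 * ∫ p, |ρ p| :=
      fun x => (abs_apply_add_abs_apply_le _).trans
        (((C3 (x, y) (1, 0)).unit_le_opNorm _ he.le).trans
          (((C3 (x, y)).unit_le_opNorm _ he.le).trans (N3 _)))
    have key := abs_second_difference_le
      (fun x => hasDerivAt_normalized (H1 (1, 0) x) (H1 (0, 1) x))
      (fun x => hasDerivAt_deriv_normalized (H1 (1, 0) x) (H1 (0, 1) x) (H2 (1, 0) x) (H2 (0, 1) x))
      (fun x => abs_normalizedSecondDeriv_le (B1 x) (B2 x)) xm Δx
    simp only [← hd1', ← hd2'] at key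
    have hJ : J₁ xp y - 2 * J₁ x0 y + J₁ xm y = -ε *
        (d1 (xm + 2 * Δx) y / √(1 + d1 (xm + 2 * Δx) y ^ 2 + d2 (xm + 2 * Δx) y ^ 2)
        - 2 * (d1 (xm + Δx) y / √(1 + d1 (xm + Δx) y ^ 2 + d2 (xm + Δx) y ^ 2))
        + d1 xm y / √(1 + d1 xm y ^ 2 + d2 xm y ^ 2)) := by
      rw [hJ₁, hJ₁, hJ₁, hx0, hxp]
      ring
    rw [hJ, abs_mul, abs_neg, abs_of_pos hε]
    refine (mul_le_mul_of_nonneg_left key hε.le).trans ?_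
    have h1 : 0 ≤ ε * Δx ^ 2 * (3 * (M3 * ∫ p, |ρ p|) + 2 * (M2 * ∫ p, |ρ p|) ^ 2) := by positivity
    linear_combination h1
  · have hzero : ∀ x y, conv x y = 0 := fun x y => by
      rw [hconv']
      exact integral_undef fun h => hex ⟨_, h⟩
    have hd0 : ∀ x y, d1 x y = 0 := fun x y => by simp [hd1, hzero]
    simp only [hJ₁, hd0, mul_zero, zero_div, neg_zero, sub_zero, add_zero, abs_zero]
    positivity
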